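/- arXiv:2211.05630 — 10 statements merged into one kernel-verified Lean document; each statement's English description precedes it below -/
import Mathlib

section
/- For every process p and every set A ⊆ Π of faulty processes: the assumptions of p are satisfied with respect to A if and only if there exists a survivor set S of p such that S ∩ A = ∅. -/
/-- A configuration: a trusted set `P` together with a collection `F` of fail-prone sets. -/
structure Config (Proc : Type) where
  P : Set Proc
  F : Set (Set Proc)

/-- `𝓕` is a fail-prone system: none of its fail-prone sets contains another. -/
def IsFPS {Proc : Type} (c : Config Proc) : Prop :=
  ∀ F ∈ c.F, ∀ F' ∈ c.F, F' ⊆ F → F' = F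

/-- A permissionless fail-prone system: a configuration for each process. -/
abbrev PFPS (Proc : Type) := Proc → Config Proc

/-- A slice of `p` (per `𝔽`) is a set of the form `P_p \ F` for some `F ∈ 𝓕_p`. -/
def IsSlice {Proc : Type} (𝔽 : PFPS Proc) (p : Proc) (S : Set Proc) : Prop :=
  ∃ F ∈ (𝔽 p).F, S = (𝔽 p).P \ F

/-- `p` has a slice in `S`: some slice of `p` is contained in `S`. -/
def HasSliceIn {Proc : Type} (𝔽 : PFPS Proc) (p : Proc) (S : Set Proc) : Prop :=
  ∃ sl, IsSlice 𝔽 p sl ∧ sl ⊆ S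

/-- The assumptions of `p` are satisfied w.r.t. the faulty set `A`: greatest
(coinductive) predicate `Sat` with `Sat p ↔ ∃ F ∈ 𝓕_p, A ∩ P_p ⊆ F ∧ ∀ q ∈ P_p \ F, Sat q`,
given here by the union of all post-fixed points. -/
def Sat {Proc : Type} (𝔽 : PFPS Proc) (A : Set Proc) (p : Proc) : Prop :=
  ∃ S : Set Proc,
    (∀ q ∈ S, ∃ F ∈ (𝔽 q).F, A ∩ (𝔽 q).P ⊆ F ∧ ∀ r ∈ (𝔽 q).P \ F, r ∈ S) ∧ p ∈ S

/-- `L` tolerates the faulty set `A`. -/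
def Tolerates {Proc : Type} (𝔽 : PFPS Proc) (L A : Set Proc) : Prop :=
  ∀ p ∈ L \ A, Sat 𝔽 A p

/-- A survivor set of `p`: `p` has a slice in `S` and every member of `S` has a slice in `S`. -/
def IsSurvivorSet {Proc : Type} (𝔽 : PFPS Proc) (p : Proc) (S : Set Proc) : Prop :=
  HasSliceIn 𝔽 p S ∧ ∀ q ∈ S, HasSliceIn 𝔽 q S

/-- A view assigns to each process either `⊥` (`none`) or a configuration. -/
abbrev View (Proc : Type) := Proc → Option (Config Proc)

/-- The PFPS `𝔽` itself, seen as the view with no `⊥` entries. -/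
def fullView {Proc : Type} (𝔽 : PFPS Proc) : View Proc := fun q => some (𝔽 q)

/-- `Q` is a quorum for `p` in view `V`: some slice of `p` (per `𝔽`) is contained in `Q`,
and every `q ∈ Q` has a non-`⊥` entry `(P_q, 𝓕_q)` in `V` with some `F ∈ 𝓕_q`
such that `P_q \ F ⊆ Q`. -/
def IsQuorum {Proc : Type} (𝔽 : PFPS Proc) (p : Proc) (V : View Proc) (Q : Set Proc) : Prop :=
  HasSliceIn 𝔽 p Q ∧
  ∀ q ∈ Q, ∃ c, V q = some c ∧ ∃ F ∈ c.F, c.P \ F ⊆ Q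

/-- A view is `T`-resilient: every process outside `T` is mapped to `⊥` or to its true
configuration. -/
def Resilient {Proc : Type} (𝔽 : PFPS Proc) (T : Set Proc) (V : View Proc) : Prop :=
  ∀ q ∉ T, V q = none ∨ V q = some (𝔽 q)

open Classical in
/-- The worst-case view w.r.t. `T`. -/
noncomputable def worstView {Proc : Type} (𝔽 : PFPS Proc) (T : Set Proc) : View Proc :=
  fun q => if q ∈ T then some ⟨∅, {∅}⟩ else some (𝔽 q)

/-- Consistency property of a league. -/
def LeagueConsistency {Proc : Type} (𝔽 : PFPS Proc) (L : Set Proc) : Prop :=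
  ∀ T : Set Proc, Tolerates 𝔽 L T →
    ∀ V V' : View Proc, Resilient 𝔽 T V → Resilient 𝔽 T V' →
      ∀ p ∈ L \ T, ∀ p' ∈ L \ T,
        ∀ Q, IsQuorum 𝔽 p V Q → ∀ Q', IsQuorum 𝔽 p' V' Q' →
          ((Q ∩ Q') \ T).Nonempty

/-- Availability property of a league. -/
def LeagueAvailability {Proc : Type} (𝔽 : PFPS Proc) (L : Set Proc) : Prop :=
  ∀ T : Set Proc, Tolerates 𝔽 L T →
    ∀ p ∈ L \ T, ∃ Q, IsQuorum 𝔽 p (fullView 𝔽) Q ∧ Q ⊆ L \ T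

/-- `L` is a league. -/
def IsLeague {Proc : Type} (𝔽 : PFPS Proc) (L : Set Proc) : Prop :=
  LeagueConsistency 𝔽 L ∧ LeagueAvailability 𝔽 L

/-- the assumptions of `p` are satisfied w.r.t. faulty set `A` iff
there is a survivor set `S` of `p` with `S ∩ A = ∅`. -/
theorem sat_iff_exists_survivor_set_disjoint
    {Proc : Type} (𝔽 : PFPS Proc) (h𝔽 : ∀ p, IsFPS (𝔽 p))
    (p : Proc) (A : Set Proc) :
    Sat 𝔽 A p ↔ ∃ S : Set Proc, IsSurvivorSet 𝔽 p S ∧ S ∩ A = ∅ := by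
  constructor
  · rintro ⟨S, hS, hp⟩
    have hasSlice : ∀ q ∈ S, HasSliceIn 𝔽 q (S \ A) := by
      intro q hq
      obtain ⟨F, hF, hAF, hFS⟩ := hS q hq
      exact ⟨_, ⟨F, hF, rfl⟩, fun r hr => ⟨hFS r hr, fun hrA => hr.2 (hAF ⟨hrA, hr.1⟩)⟩⟩
    exact ⟨S \ A, ⟨hasSlice p hp, fun q hq => hasSlice q hq.1⟩, Set.sdiff_inter_self⟩
  · rintro ⟨S, ⟨hp, hS⟩, hSA⟩
    refine ⟨insert p S, fun q hq => ?_, Set.mem_insert p S⟩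
    have hq' : HasSliceIn 𝔽 q S := by
      rcases hq with rfl | hq
      exacts [hp, hS q hq]
    obtain ⟨_, ⟨F, hF, rfl⟩, hFS⟩ := hq'
    refine ⟨F, hF, fun r hr => ?_, fun r hr => Set.mem_insert_of_mem p (hFS hr)⟩
    by_contra hrF
    exact (Set.disjoint_iff_inter_eq_empty.mpr hSA).notMem_of_mem_left (hFS ⟨hr.2, hrF⟩) hr.1
end

section
/- Let T ⊆ Π, let V be a T-resilient view, and let p ∉ T be a process. Then for every quorum Q ∈ 𝒬(p, V) there exists a quorum Q' ∈ 𝒬(p, V*_T) (in the worst-case view with respect to T) such that Q' ⊆ Q. -/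
/-- A quorum in a `T`-resilient view is itself a quorum in the worst-case view w.r.t. `T`. -/
theorem IsQuorum.worstView {Proc : Type} {𝔽 : PFPS Proc} {T : Set Proc} {V : View Proc}
    (hV : Resilient 𝔽 T V) {p : Proc} {Q : Set Proc} (hQ : IsQuorum 𝔽 p V Q) :
    IsQuorum 𝔽 p (worstView 𝔽 T) Q := by
  refine ⟨hQ.1, fun q hq => ?_⟩
  by_cases hqT : q ∈ T
  · exact ⟨⟨∅, {∅}⟩, if_pos hqT, ∅, rfl, by simp⟩
  · obtain ⟨c, hc, hF⟩ := hQ.2 q hq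
    rcases hV q hqT with h | h
    · simp [h] at hc
    · exact ⟨c, (if_neg hqT).trans (h.symm.trans hc), hF⟩

/-- every quorum of `p ∉ T` in a `T`-resilient view contains a quorum
of `p` in the worst-case view w.r.t. `T`. -/
theorem worst_case_quorum_contained
    {Proc : Type} (𝔽 : PFPS Proc) (h𝔽 : ∀ p, IsFPS (𝔽 p))
    (T : Set Proc) (V : View Proc) (hV : Resilient 𝔽 T V)
    (p : Proc) (hp : p ∉ T) (Q : Set Proc) (hQ : IsQuorum 𝔽 p V Q) :
    ∃ Q', IsQuorum 𝔽 p (worstView 𝔽 T) Q' ∧ Q' ⊆ Q := by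
  exact ⟨Q, hQ.worstView hV, subset_rfl⟩
end

section
/- A set L ⊆ Π satisfies the Consistency property of a league if and only if for every set T ⊆ Π tolerated by L and for every two sets I, I' ⊆ Π that are each inclusive up to T and rooted at some member of L \ T, it holds that (I ∩ I') \ T ≠ ∅. -/
/-- `I` is inclusive up to `T`: every member of `I \ T` has a slice in `I`. -/
def InclusiveUpTo {Proc : Type} (𝔽 : PFPS Proc) (I T : Set Proc) : Prop :=
  ∀ q ∈ I \ T, HasSliceIn 𝔽 q I

/-- `R` is rooted at `p`: `p` has a slice in `R`. -/
def RootedAt {Proc : Type} (𝔽 : PFPS Proc) (R : Set Proc) (p : Proc) : Prop :=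
  HasSliceIn 𝔽 p R

theorem resilient_worstView {Proc : Type} (𝔽 : PFPS Proc) (T : Set Proc) :
    Resilient 𝔽 T (worstView 𝔽 T) :=
  fun _ hq => Or.inr (if_neg hq)

/-- A quorum in a `T`-resilient view is inclusive up to `T`. -/
theorem IsQuorum.inclusiveUpTo {Proc : Type} {𝔽 : PFPS Proc} {p : Proc} {T Q : Set Proc}
    {V : View Proc} (hQ : IsQuorum 𝔽 p V Q) (hV : Resilient 𝔽 T V) : InclusiveUpTo 𝔽 Q T := by
  rintro q ⟨hq, hqT⟩
  obtain ⟨c, hc, F, hF, hsub⟩ := hQ.2 q hq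
  obtain h | h := hV q hqT
  · simp [h] at hc
  · obtain rfl : 𝔽 q = c := Option.some.inj (h.symm.trans hc)
    exact ⟨_, ⟨F, hF, rfl⟩, hsub⟩

/-- A set inclusive up to `T` and rooted at `p` is a quorum for `p` in the worst-case view. -/
theorem InclusiveUpTo.isQuorum_worstView {Proc : Type} {𝔽 : PFPS Proc} {p : Proc}
    {I T : Set Proc} (hI : InclusiveUpTo 𝔽 I T) (hp : RootedAt 𝔽 I p) :
    IsQuorum 𝔽 p (worstView 𝔽 T) I := by
  refine ⟨hp, fun q hq => ?_⟩
  by_cases hqT : q ∈ T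
  · exact ⟨⟨∅, {∅}⟩, if_pos hqT, ∅, rfl, by simp⟩
  · obtain ⟨_, ⟨F, hF, rfl⟩, hsub⟩ := hI q ⟨hq, hqT⟩
    exact ⟨𝔽 q, if_neg hqT, F, hF, hsub⟩

/-- the Consistency property of a league holds iff any two sets that are
inclusive up to a tolerated `T` and rooted at members of `L \ T` intersect outside `T`. -/
theorem consistency_iff_inclusive_rooted
    {Proc : Type} (𝔽 : PFPS Proc) (h𝔽 : ∀ p, IsFPS (𝔽 p)) (L : Set Proc) :
    LeagueConsistency 𝔽 L ↔
      ∀ T : Set Proc, Tolerates 𝔽 L T →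
        ∀ I I' : Set Proc,
          InclusiveUpTo 𝔽 I T → (∃ p ∈ L \ T, RootedAt 𝔽 I p) →
          InclusiveUpTo 𝔽 I' T → (∃ p ∈ L \ T, RootedAt 𝔽 I' p) →
          ((I ∩ I') \ T).Nonempty := by
  constructor
  · rintro h T hT I I' hI ⟨p, hp, hpI⟩ hI' ⟨p', hp', hpI'⟩
    exact h T hT _ _ (resilient_worstView 𝔽 T) (resilient_worstView 𝔽 T) p hp p' hp'
      I (hI.isQuorum_worstView hpI) I' (hI'.isQuorum_worstView hpI')
  · intro h T hT V V' hV hV' p hp p' hp' Q hQ Q' hQ'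
    exact h T hT Q Q' (hQ.inclusiveUpTo hV) ⟨p, hp, hQ.1⟩ (hQ'.inclusiveUpTo hV') ⟨p', hp', hQ'.1⟩
end

section
/- Let Π = {p_1,…,p_n} be a finite set of processes and 𝓕 a fail-prone system over Π. Then the Q³-condition Q³(𝓕) holds if and only if Π is a league with respect to the PFPS f(𝓕) in which every process has configuration (Π, 𝓕). -/
/-- The symmetric PFPS `f(𝓕)` in which every process has configuration `(Π, 𝓕)`. -/
def symPFPS {Proc : Type} (𝓕 : Set (Set Proc)) : PFPS Proc :=
  fun _ => ⟨Set.univ, 𝓕⟩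

/-- The `Q³`-condition: no three fail-prone sets cover `Π`. -/
def Q3 {Proc : Type} (𝓕 : Set (Set Proc)) : Prop :=
  ∀ F₁ ∈ 𝓕, ∀ F₂ ∈ 𝓕, ∀ F₃ ∈ 𝓕, ¬ ((Set.univ : Set Proc) ⊆ F₁ ∪ F₂ ∪ F₃)

/-- Under the symmetric PFPS, the assumptions of a process are satisfied exactly when some
fail-prone set contains all faulty processes. -/
theorem symPFPS_sat_iff {Proc : Type} {𝓕 : Set (Set Proc)} {A : Set Proc} {p : Proc} :
    Sat (symPFPS 𝓕) A p ↔ ∃ F ∈ 𝓕, A ⊆ F := by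
  constructor
  · rintro ⟨S, hS, hp⟩
    obtain ⟨F, hF, hAF, -⟩ := hS p hp
    exact ⟨F, hF, fun x hx => hAF ⟨hx, Set.mem_univ x⟩⟩
  · rintro ⟨F, hF, hAF⟩
    exact ⟨Set.univ, fun _ _ => ⟨F, hF, fun x hx => hAF hx.1, fun r _ => Set.mem_univ r⟩,
      Set.mem_univ p⟩

/-- The complement of a fail-prone set is a quorum of every process in the full view. -/
theorem symPFPS_isQuorum_compl {Proc : Type} {𝓕 : Set (Set Proc)} {F : Set Proc} (hF : F ∈ 𝓕)
    (p : Proc) : IsQuorum (symPFPS 𝓕) p (fullView (symPFPS 𝓕)) (Set.univ \ F) :=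
  ⟨⟨Set.univ \ F, ⟨F, hF, rfl⟩, subset_rfl⟩, fun q _ => ⟨symPFPS 𝓕 q, rfl, F, hF, subset_rfl⟩⟩

/-- Every quorum contains the complement of some fail-prone set. -/
theorem IsQuorum.exists_compl_subset {Proc : Type} {𝓕 : Set (Set Proc)} {p : Proc}
    {V : View Proc} {Q : Set Proc} (hQ : IsQuorum (symPFPS 𝓕) p V Q) :
    ∃ F ∈ 𝓕, Set.univ \ F ⊆ Q := by
  obtain ⟨⟨_, ⟨F, hF, rfl⟩, hsub⟩, -⟩ := hQ
  exact ⟨F, hF, hsub⟩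

/-- If `Π` satisfies consistency, then two fail-prone sets together with a proper subset of `Π`
contained in a fail-prone set do not cover `Π`. -/
theorem LeagueConsistency.not_univ_subset {Proc : Type} {𝓕 : Set (Set Proc)}
    (h : LeagueConsistency (symPFPS 𝓕) Set.univ) {F₁ F₂ F T : Set Proc} (h₁ : F₁ ∈ 𝓕)
    (h₂ : F₂ ∈ 𝓕) (hF : F ∈ 𝓕) (hT : T ⊆ F) {p : Proc} (hp : p ∉ T) :
    ¬ Set.univ ⊆ F₁ ∪ F₂ ∪ T := by
  intro hcov
  have hres : Resilient (symPFPS 𝓕) T (fullView (symPFPS 𝓕)) := fun _ _ => Or.inr rfl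
  obtain ⟨x, ⟨hx₁, hx₂⟩, hxT⟩ := h T (fun _ _ => symPFPS_sat_iff.2 ⟨F, hF, hT⟩) _ _ hres hres
    p ⟨Set.mem_univ p, hp⟩ p ⟨Set.mem_univ p, hp⟩ _ (symPFPS_isQuorum_compl h₁ p)
    _ (symPFPS_isQuorum_compl h₂ p)
  rcases hcov (Set.mem_univ x) with (hx | hx) | hx
  · exact hx₁.2 hx
  · exact hx₂.2 hx
  · exact hxT hx

/-- for a finite set of processes and a fail-prone system `𝓕` over `Π`,
`Q³(𝓕)` holds iff `Π` is a league w.r.t. the PFPS `f(𝓕)`. -/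
theorem q3_iff_univ_league
    {Proc : Type} [Fintype Proc] [Nonempty Proc]
    (𝓕 : Set (Set Proc)) (h𝓕 : IsFPS (⟨Set.univ, 𝓕⟩ : Config Proc)) :
    Q3 𝓕 ↔ IsLeague (symPFPS 𝓕) (Set.univ : Set Proc) := by
  constructor
  · intro hQ3
    refine ⟨?_, ?_⟩
    · intro T hT V V' _ _ p hp p' _ Q hQ Q' hQ'
      obtain ⟨F, hF, hTF⟩ := symPFPS_sat_iff.1 (hT p hp)
      obtain ⟨F₁, h₁, hs₁⟩ := hQ.exists_compl_subset
      obtain ⟨F₂, h₂, hs₂⟩ := hQ'.exists_compl_subset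
      obtain ⟨x, -, hx⟩ := Set.not_subset.1 (hQ3 F₁ h₁ F₂ h₂ F hF)
      exact ⟨x, ⟨hs₁ ⟨Set.mem_univ x, fun h => hx (Or.inl (Or.inl h))⟩,
        hs₂ ⟨Set.mem_univ x, fun h => hx (Or.inl (Or.inr h))⟩⟩, fun h => hx (Or.inr (hTF h))⟩
    · intro T hT p hp
      obtain ⟨F, hF, hTF⟩ := symPFPS_sat_iff.1 (hT p hp)
      exact ⟨_, symPFPS_isQuorum_compl hF p, Set.sdiff_subset_sdiff_right hTF⟩
  · rintro ⟨hcons, -⟩ F₁ h₁ F₂ h₂ F₃ h₃ hcov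
    by_cases hF₃ : ∃ p, p ∉ F₃
    · obtain ⟨p, hp⟩ := hF₃
      exact hcons.not_univ_subset h₁ h₂ h₃ subset_rfl hp hcov
    · push Not at hF₃
      obtain ⟨p⟩ := ‹Nonempty Proc›
      exact hcons.not_univ_subset h₃ h₃ h₃ (Set.empty_subset F₃) (Set.notMem_empty p)
        fun x _ => Or.inl (Or.inl (hF₃ x))
end

section
/- Let Π = {p_1,…,p_n} be a finite set of processes and 𝔽' = [𝓕'_1,…,𝓕'_n] an asymmetric fail-prone system over Π. If the B³-condition B³(𝔽') holds, then Π is a league with respect to the PFPS g(𝔽') in which each process p_i has configuration (Π, 𝓕'_i). -/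
/-- The PFPS `g(𝔽')` in which each process `p` has configuration `(Π, 𝓕'_p)`. -/
def asymPFPS {Proc : Type} (𝔽' : Proc → Set (Set Proc)) : PFPS Proc :=
  fun p => ⟨Set.univ, 𝔽' p⟩

/-- The `B³`-condition for an asymmetric fail-prone system. -/
def B3 {Proc : Type} (𝔽' : Proc → Set (Set Proc)) : Prop :=
  ∀ i j : Proc, ∀ Fi ∈ 𝔽' i, ∀ Fj ∈ 𝔽' j, ∀ Fij : Set Proc,
    (∃ F ∈ 𝔽' i, Fij ⊆ F) → (∃ F ∈ 𝔽' j, Fij ⊆ F) →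
      ¬ ((Set.univ : Set Proc) ⊆ Fi ∪ Fj ∪ Fij)

/-- If `Π` tolerates `T`, every process outside `T` has a fail-prone set containing `T`. -/
theorem exists_failProne_superset {Proc : Type} {𝔽' : Proc → Set (Set Proc)} {T : Set Proc}
    (hT : Tolerates (asymPFPS 𝔽') Set.univ T) {p : Proc} (hp : p ∉ T) :
    ∃ F ∈ 𝔽' p, T ⊆ F := by
  obtain ⟨S, hS, hpS⟩ := hT p ⟨Set.mem_univ p, hp⟩
  obtain ⟨F, hF, hTF, -⟩ := hS p hpS
  exact ⟨F, hF, fun x hx => hTF ⟨hx, Set.mem_univ x⟩⟩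

/-- if `B³(𝔽')` holds, then `Π` is a league w.r.t. the PFPS `g(𝔽')`. -/
theorem b3_implies_univ_league
    {Proc : Type} [Fintype Proc] [Nonempty Proc]
    (𝔽' : Proc → Set (Set Proc)) (h𝔽' : ∀ p, IsFPS (⟨Set.univ, 𝔽' p⟩ : Config Proc))
    (hB3 : B3 𝔽') :
    IsLeague (asymPFPS 𝔽') (Set.univ : Set Proc) := by
  refine ⟨?_, ?_⟩
  · rintro T hT V V' - - p ⟨-, hp⟩ p' ⟨-, hp'⟩ Q ⟨⟨_, ⟨F, hF, rfl⟩, hQ⟩, -⟩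
      Q' ⟨⟨_, ⟨F', hF', rfl⟩, hQ'⟩, -⟩
    obtain ⟨x, -, hx⟩ := Set.not_subset.mp <| hB3 p p' F hF F' hF' T
      (exists_failProne_superset hT hp) (exists_failProne_superset hT hp')
    simp only [Set.mem_union, not_or] at hx
    exact ⟨x, ⟨hQ ⟨Set.mem_univ x, hx.1.1⟩, hQ' ⟨Set.mem_univ x, hx.1.2⟩⟩, hx.2⟩
  · rintro T hT p ⟨-, hp⟩
    have slice : ∀ q ∉ T, ∃ F ∈ 𝔽' q, Set.univ \ F ⊆ Set.univ \ T := fun q hq =>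
      let ⟨F, hF, hTF⟩ := exists_failProne_superset hT hq
      ⟨F, hF, Set.sdiff_subset_sdiff_right hTF⟩
    obtain ⟨F, hF, hFT⟩ := slice p hp
    exact ⟨Set.univ \ T, ⟨⟨_, ⟨F, hF, rfl⟩, hFT⟩, fun q hq => ⟨_, rfl, slice q hq.2⟩⟩,
      subset_rfl⟩
end

section
/- Let Π = {p_1,…,p_n} be a finite set of processes, 𝔽' = [𝓕'_1,…,𝓕'_n] an asymmetric fail-prone system over Π, A ⊆ Π a set of faulty processes, and 𝒢 a guild for A. Then 𝒢 tolerates A with respect to the PFPS g(𝔽'); that is, the assumptions of every process in 𝒢 are satisfied with respect to the faulty set A. -/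
/-- `p` is wise for the faulty set `A`: `p ∉ A` and `A` is contained in one of `p`'s
fail-prone sets. -/
def Wise {Proc : Type} (𝔽' : Proc → Set (Set Proc)) (A : Set Proc) (p : Proc) : Prop :=
  p ∉ A ∧ ∃ F ∈ 𝔽' p, A ⊆ F

/-- `𝒢` is a guild for `A`: every member is wise and has a canonical quorum `Π \ F`
(for some `F ∈ 𝓕'_p`) contained in `𝒢`. -/
def IsGuild {Proc : Type} (𝔽' : Proc → Set (Set Proc)) (A 𝒢 : Set Proc) : Prop :=
  ∀ p ∈ 𝒢, Wise 𝔽' A p ∧ ∃ F ∈ 𝔽' p, (Set.univ : Set Proc) \ F ⊆ 𝒢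

/-- a guild `𝒢` for `A` tolerates `A` w.r.t. `g(𝔽')`; indeed the
assumptions of every member of `𝒢` are satisfied w.r.t. the faulty set `A`. -/
theorem guild_tolerates
    {Proc : Type} [Fintype Proc]
    (𝔽' : Proc → Set (Set Proc)) (h𝔽' : ∀ p, IsFPS (⟨Set.univ, 𝔽' p⟩ : Config Proc))
    (A 𝒢 : Set Proc) (hguild : IsGuild 𝔽' A 𝒢) :
    Tolerates (asymPFPS 𝔽') 𝒢 A ∧ ∀ p ∈ 𝒢, Sat (asymPFPS 𝔽') A p := by
  have hsat : ∀ p ∈ 𝒢, Sat (asymPFPS 𝔽') A p := by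
    refine fun p hp => ⟨𝒢, fun q hq => ?_, hp⟩
    obtain ⟨F, hF, hquorum⟩ := (hguild q hq).2
    refine ⟨F, hF, fun a ha => ?_, hquorum⟩
    by_contra haF
    exact (hguild a (hquorum ⟨Set.mem_univ a, haF⟩)).1.1 ha.1
  exact ⟨fun p hp => hsat p hp.1, hsat⟩
end

section
/- There exists an asymmetric fail-prone system 𝔽' over a set Π = {p₁, p₂, p₃, p₄} of four processes — namely 𝓕'₁ = {{p₃,p₄}}, 𝓕'₂ = {{p₁,p₄}}, 𝓕'₃ = {{p₁,p₄}}, 𝓕'₄ = {{p₁,p₂}} — such that (a) there is no asymmetric Byzantine quorum system for 𝔽', but (b) Π is a league with respect to the PFPS g(𝔽') in which each process p_i has configuration (Π, 𝓕'_i). -/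
/-- `𝔔` is an asymmetric Byzantine quorum system for `𝔽'`. -/
def IsAsymQuorumSystem {Proc : Type} (𝔽' 𝔔 : Proc → Set (Set Proc)) : Prop :=
  (∀ i j : Proc, ∀ Qi ∈ 𝔔 i, ∀ Qj ∈ 𝔔 j, ∀ Fij : Set Proc,
      (∃ F ∈ 𝔽' i, Fij ⊆ F) → (∃ F ∈ 𝔽' j, Fij ⊆ F) → ¬ (Qi ∩ Qj ⊆ Fij)) ∧
  (∀ i : Proc, ∀ F ∈ 𝔽' i, ∃ Q ∈ 𝔔 i, F ∩ Q = ∅)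

/-- The concrete asymmetric fail-prone system over four processes:
`𝓕'₁ = {{p₃,p₄}}`, `𝓕'₂ = {{p₁,p₄}}`, `𝓕'₃ = {{p₁,p₄}}`, `𝓕'₄ = {{p₁,p₂}}`
(0-indexed over `Fin 4`). -/
def F4ex : Fin 4 → Set (Set (Fin 4)) :=
  ![{{2, 3}}, {{0, 3}}, {{0, 3}}, {{0, 1}}]

/-- Satisfied assumptions unfold: some fail-prone set covers the faulty processes and everyone
outside of it has satisfied assumptions. -/
theorem Sat.unfold {Proc : Type} {𝔽 : PFPS Proc} {A : Set Proc} {p : Proc} (h : Sat 𝔽 A p) :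
    ∃ F ∈ (𝔽 p).F, A ∩ (𝔽 p).P ⊆ F ∧ ∀ q ∈ (𝔽 p).P \ F, Sat 𝔽 A q := by
  obtain ⟨S, hS, hp⟩ := h
  obtain ⟨F, hF, hA, hr⟩ := hS p hp
  exact ⟨F, hF, hA, fun q hq => ⟨S, hS, hr q hq⟩⟩

/-- When every process trusts all processes, the set of all processes satisfies availability:
the correct processes form a quorum. -/
theorem leagueAvailability_asymPFPS {Proc : Type} (𝔽' : Proc → Set (Set Proc)) :
    LeagueAvailability (asymPFPS 𝔽') Set.univ := by
  intro T hT
  have key : ∀ q ∉ T, ∃ F ∈ 𝔽' q, Set.univ \ F ⊆ Tᶜ := by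
    intro q hq
    obtain ⟨F, hF, hA, -⟩ := (hT q ⟨trivial, hq⟩).unfold
    exact ⟨F, hF, fun r hr hrT => hr.2 (hA ⟨hrT, trivial⟩)⟩
  intro p hp
  obtain ⟨F, hF, hsub⟩ := key p hp.2
  exact ⟨Tᶜ, ⟨⟨_, ⟨F, hF, rfl⟩, hsub⟩, fun q hq => ⟨_, rfl, key q hq⟩⟩,
    fun q hq => ⟨trivial, hq⟩⟩

/-- The unique fail-prone set of each process in `F4ex`. -/
def F4exSet : Fin 4 → Set (Fin 4) := ![{2, 3}, {0, 3}, {0, 3}, {0, 1}]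

theorem F4ex_eq (p : Fin 4) : F4ex p = {F4exSet p} := by
  fin_cases p <;> rfl

theorem one_or_two_notMem_F4exSet (p : Fin 4) : 1 ∉ F4exSet p ∨ 2 ∉ F4exSet p := by
  fin_cases p <;> simp [F4exSet]

theorem one_notMem_F4exSet_one : (1 : Fin 4) ∉ F4exSet 1 := by simp [F4exSet]

theorem two_notMem_F4exSet_one : (2 : Fin 4) ∉ F4exSet 1 := by simp [F4exSet]

theorem F4exSet_two : F4exSet 2 = F4exSet 1 := rfl

theorem Sat.unfold_F4ex {T : Set (Fin 4)} {p : Fin 4} (h : Sat (asymPFPS F4ex) T p) :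
    T ⊆ F4exSet p ∧ ∀ q ∉ F4exSet p, Sat (asymPFPS F4ex) T q := by
  obtain ⟨F, hF, hA, hq⟩ := h.unfold
  obtain rfl : F = F4exSet p := by simpa [asymPFPS, F4ex_eq] using hF
  exact ⟨fun x hx => hA ⟨hx, trivial⟩, fun q h => hq q ⟨trivial, h⟩⟩

/-- If some process has satisfied assumptions, the second and third processes are correct. -/
theorem notMem_of_sat_F4ex {T : Set (Fin 4)} {p : Fin 4} (h : Sat (asymPFPS F4ex) T p) :
    1 ∉ T ∧ 2 ∉ T := by
  have hsub : T ⊆ F4exSet 1 := by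
    rcases one_or_two_notMem_F4exSet p with h1 | h2
    · exact (h.unfold_F4ex.2 1 h1).unfold_F4ex.1
    · exact F4exSet_two ▸ (h.unfold_F4ex.2 2 h2).unfold_F4ex.1
  exact ⟨fun h1 => one_notMem_F4exSet_one (hsub h1), fun h2 => two_notMem_F4exSet_one (hsub h2)⟩

/-- In a resilient view in which the third process is correct, every quorum
contains the second process. -/
theorem one_mem_of_isQuorum_F4ex {T : Set (Fin 4)} (hT : 2 ∉ T) {V : View (Fin 4)}
    (hV : Resilient (asymPFPS F4ex) T V) {p : Fin 4} {Q : Set (Fin 4)}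
    (hQ : IsQuorum (asymPFPS F4ex) p V Q) : 1 ∈ Q := by
  obtain ⟨⟨_, ⟨F, hF, rfl⟩, hsub⟩, hmem⟩ := hQ
  obtain rfl : F = F4exSet p := by simpa [asymPFPS, F4ex_eq] using hF
  rcases one_or_two_notMem_F4exSet p with h1 | h2
  · exact hsub ⟨trivial, h1⟩
  · obtain ⟨c, hc, F, hF, hFQ⟩ := hmem 2 (hsub ⟨trivial, h2⟩)
    rcases hV 2 hT with h | h
    · simp [h] at hc
    · obtain rfl : asymPFPS F4ex 2 = c := by simpa [h] using hc
      obtain rfl : F = F4exSet 2 := by simpa [asymPFPS, F4ex_eq] using hF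
      exact hFQ ⟨trivial, one_notMem_F4exSet_one⟩

theorem not_isAsymQuorumSystem_F4ex (𝔔 : Fin 4 → Set (Set (Fin 4))) :
    ¬ IsAsymQuorumSystem F4ex 𝔔 := by
  rintro ⟨hcons, hav⟩
  obtain ⟨Q, hQ, hFQ⟩ := hav 0 (F4exSet 0) (by simp [F4ex_eq])
  obtain ⟨Q', hQ', hFQ'⟩ := hav 3 (F4exSet 3) (by simp [F4ex_eq])
  refine hcons 0 3 Q hQ Q' hQ' ∅ ⟨F4exSet 0, by simp [F4ex_eq], Set.empty_subset _⟩
    ⟨F4exSet 3, by simp [F4ex_eq], Set.empty_subset _⟩ ?_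
  rintro x ⟨hxQ, hxR⟩
  have hcover : x ∈ F4exSet 0 ∨ x ∈ F4exSet 3 := by
    fin_cases x <;> simp [F4exSet]
  rcases hcover with h | h
  · exact hFQ ▸ ⟨h, hxQ⟩
  · exact hFQ' ▸ ⟨h, hxR⟩

/-- for the asymmetric fail-prone system `F4ex` there is no asymmetric
Byzantine quorum system, yet `Π` is a league w.r.t. the PFPS `g(F4ex)`. -/
theorem no_asym_qs_but_league :
    (¬ ∃ 𝔔 : Fin 4 → Set (Set (Fin 4)), IsAsymQuorumSystem F4ex 𝔔) ∧
    IsLeague (asymPFPS F4ex) (Set.univ : Set (Fin 4)) := by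
  refine ⟨fun ⟨𝔔, h⟩ => not_isAsymQuorumSystem_F4ex 𝔔 h, ?_, leagueAvailability_asymPFPS F4ex⟩
  intro T hT V V' hV hV' p hp p' _ Q hQ Q' hQ'
  obtain ⟨h1, h2⟩ := notMem_of_sat_F4ex (hT p hp)
  exact ⟨1, ⟨one_mem_of_isQuorum_F4ex h2 hV hQ, one_mem_of_isQuorum_F4ex h2 hV' hQ'⟩, h1⟩
end

section
/- Let L be a league satisfying the following strengthened Consistency property: for every set T ⊆ Π tolerated by L, every two T-resilient views V and V', every two processes p, p' ∈ L \ T, and every two quorums Q ∈ 𝒬(p, V) and Q' ∈ 𝒬(p', V'), it holds that (Q ∩ Q' ∩ L) \ T ≠ ∅. Then for every set T ⊆ Π tolerated by L, the set L \ T is an intact set for the faulty set T. -/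
/-- `I` is an intact set for the faulty set `A`. -/
def IsIntact {Proc : Type} (𝔽 : PFPS Proc) (A I : Set Proc) : Prop :=
  I ⊆ Aᶜ ∧
  (∀ p ∈ I, ∀ p' ∈ I, ∀ V V' : View Proc, Resilient 𝔽 A V → Resilient 𝔽 A V' →
    ∀ Q, IsQuorum 𝔽 p V Q → ∀ Q', IsQuorum 𝔽 p' V' Q' → (Q ∩ Q' ∩ I).Nonempty) ∧
  (∀ p ∈ I, IsQuorum 𝔽 p (fullView 𝔽) I)

/-- a league with the strengthened Consistency property yields an
intact set `L \ T` for every tolerated `T`. -/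
theorem league_strong_consistency_intact
    {Proc : Type} (𝔽 : PFPS Proc) (h𝔽 : ∀ p, IsFPS (𝔽 p))
    (L : Set Proc) (hL : IsLeague 𝔽 L)
    (hstrong : ∀ T : Set Proc, Tolerates 𝔽 L T →
      ∀ V V' : View Proc, Resilient 𝔽 T V → Resilient 𝔽 T V' →
        ∀ p ∈ L \ T, ∀ p' ∈ L \ T,
          ∀ Q, IsQuorum 𝔽 p V Q → ∀ Q', IsQuorum 𝔽 p' V' Q' →
            ((Q ∩ Q' ∩ L) \ T).Nonempty) :
    ∀ T : Set Proc, Tolerates 𝔽 L T → IsIntact 𝔽 T (L \ T) := by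
  intro T hT
  refine ⟨fun p hp => hp.2, fun p hp p' hp' V V' hV hV' Q hQ Q' hQ' => ?_, fun p hp => ?_⟩
  · rw [← Set.inter_sdiff_assoc]
    exact hstrong T hT V V' hV hV' p hp p' hp' Q hQ Q' hQ'
  · have hslice : ∀ q ∈ L \ T, HasSliceIn 𝔽 q (L \ T) := by
      intro q hq
      obtain ⟨Q, ⟨⟨S, hS, hSQ⟩, -⟩, hQ⟩ := hL.2 T hT q hq
      exact ⟨S, hS, hSQ.trans hQ⟩
    refine ⟨hslice p hp, fun q hq => ?_⟩
    obtain ⟨_, ⟨F, hF, rfl⟩, hsub⟩ := hslice q hq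
    exact ⟨𝔽 q, rfl, F, hF, hsub⟩
end

section
/- Let L be a league and T ⊆ Π a set tolerated by L. Then no process in L \ T is inductively blocked by T; that is, T⁺ ∩ (L \ T) = ∅. -/
/-- `B` blocks `p`: `B` intersects every slice of `p`. -/
def Blocks {Proc : Type} (𝔽 : PFPS Proc) (B : Set Proc) (p : Proc) : Prop :=
  ∀ S, IsSlice 𝔽 p S → (B ∩ S).Nonempty

/-- `B⁺`: the smallest set of processes containing `B` and closed under the rule
"if `B⁺` blocks `p` then `p ∈ B⁺`", given as the intersection of all such closed sets.
A process is inductively blocked by `B` iff it belongs to `B⁺`. -/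
def BPlus {Proc : Type} (𝔽 : PFPS Proc) (B : Set Proc) : Set Proc :=
  ⋂₀ {C : Set Proc | B ⊆ C ∧ ∀ p, Blocks 𝔽 C p → p ∈ C}

/-- if `L` is a league and `T` is tolerated by `L`, then no process of
`L \ T` is inductively blocked by `T`: `T⁺ ∩ (L \ T) = ∅`. -/
theorem league_not_inductively_blocked
    {Proc : Type} (𝔽 : PFPS Proc) (h𝔽 : ∀ p, IsFPS (𝔽 p))
    (L T : Set Proc) (hL : IsLeague 𝔽 L) (hT : Tolerates 𝔽 L T) :
    BPlus 𝔽 T ∩ (L \ T) = ∅ := by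
  rw [Set.eq_empty_iff_forall_notMem]
  rintro p ⟨hpB, hpL⟩
  obtain ⟨Q, ⟨hpQ, hQ⟩, hQL⟩ := hL.2 T hT p hpL
  have hslice : ∀ q ∈ insert p Q, HasSliceIn 𝔽 q Q := by
    rintro q (rfl | hq)
    · exact hpQ
    · obtain ⟨c, hc, F, hF, hFQ⟩ := hQ q hq
      obtain rfl : 𝔽 q = c := Option.some.inj hc
      exact ⟨_, ⟨F, hF, rfl⟩, hFQ⟩
  refine hpB (insert p Q)ᶜ ⟨?_, ?_⟩ (Set.mem_insert p Q)
  · rintro t ht (rfl | htQ)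
    · exact hpL.2 ht
    · exact (hQL htQ).2 ht
  · intro q hblock hq
    obtain ⟨S, hS, hSQ⟩ := hslice q hq
    obtain ⟨r, hr, hrS⟩ := hblock S hS
    exact hr (Or.inr (hSQ hrS))
end

section
/- (Cascade theorem) Let L be a league, T ⊆ Π a set tolerated by L, p ∈ L \ T a process, V a T-resilient view, Q ∈ 𝒬(p, V) a quorum for p, and B ⊆ Π a set disjoint from T such that Q \ T ⊆ B. Then either L \ T ⊆ B, or there exists a process q ∉ B ∪ T that is blocked by B. -/
/-- A process that is not blocked by `B` has a slice in the complement of `B`. -/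
theorem exists_sdiff_subset_compl_of_not_blocks {Proc : Type} {𝔽 : PFPS Proc} {B : Set Proc}
    {q : Proc} (h : ¬ Blocks 𝔽 B q) : ∃ F ∈ (𝔽 q).F, (𝔽 q).P \ F ⊆ Bᶜ := by
  simp only [Blocks, not_forall] at h
  obtain ⟨S, ⟨F, hF, rfl⟩, hS⟩ := h
  exact ⟨F, hF, fun r hr hB => hS ⟨r, hB, hr⟩⟩

/-- If `B` blocks no process outside `B ∪ T`, then its complement is a quorum, in the worst-case
view w.r.t. `T`, for every process outside `B ∪ T`. -/
theorem isQuorum_worstView_compl {Proc : Type} {𝔽 : PFPS Proc} {B T : Set Proc}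
    (h : ∀ q, q ∉ B ∪ T → ¬ Blocks 𝔽 B q) {p : Proc} (hp : p ∉ B ∪ T) :
    IsQuorum 𝔽 p (worstView 𝔽 T) Bᶜ := by
  constructor
  · obtain ⟨F, hF, hs⟩ := exists_sdiff_subset_compl_of_not_blocks (h p hp)
    exact ⟨_, ⟨F, hF, rfl⟩, hs⟩
  · intro q hq
    by_cases hqT : q ∈ T
    · exact ⟨⟨∅, {∅}⟩, by simp [worstView, hqT], ∅, rfl, by simp⟩
    · exact ⟨𝔽 q, by simp [worstView, hqT],
        exists_sdiff_subset_compl_of_not_blocks (h q fun hqBT => hqBT.elim hq hqT)⟩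

/-- Cascade theorem: given a league `L`, a tolerated `T`, `p ∈ L \ T`,
a quorum `Q` of `p` in a `T`-resilient view, and a set `B` disjoint from `T` with
`Q \ T ⊆ B`: either `L \ T ⊆ B`, or some process outside `B ∪ T` is blocked by `B`. -/
theorem cascade
    {Proc : Type} (𝔽 : PFPS Proc) (h𝔽 : ∀ p, IsFPS (𝔽 p))
    (L T : Set Proc) (hL : IsLeague 𝔽 L) (hT : Tolerates 𝔽 L T)
    (p : Proc) (hp : p ∈ L \ T)
    (V : View Proc) (hV : Resilient 𝔽 T V)
    (Q : Set Proc) (hQ : IsQuorum 𝔽 p V Q)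
    (B : Set Proc) (hBT : B ∩ T = ∅) (hQB : Q \ T ⊆ B) :
    L \ T ⊆ B ∨ ∃ q, q ∉ B ∪ T ∧ Blocks 𝔽 B q := by
  by_contra! hcon
  obtain ⟨hsub, hblock⟩ := hcon
  obtain ⟨p', hp', hp'B⟩ := Set.not_subset.mp hsub
  obtain ⟨r, ⟨hrQ, hrB⟩, hrT⟩ := hL.1 T hT V _ hV (resilient_worstView 𝔽 T) p hp p' hp' Q hQ Bᶜ
    (isQuorum_worstView_compl hblock fun h => h.elim hp'B hp'.2)
  exact hrB (hQB ⟨hrQ, hrT⟩)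
end
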